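/- Let E and F be disjoint nonempty closed subsets of the Riemann sphere ℂ̂ with ∞ ∈ F, and suppose that U := ℂ̂ ∖ (E ∪ F) is connected. Then there exists a Jordan loop γ whose image is contained in U ∩ ℂ, whose image is a finite union of horizontal and vertical segments, and whose image separates E and F, i.e. no connected component of ℂ̂ ∖ γ '' [0,1] contains points of both E and F. -/

import Mathlib

open Set OnePoint

/-- A Jordan loop: a continuous map `γ : [0,1] → ℂ` with `γ 0 = γ 1` whose
restriction to `[0,1)` is injective. -/
def IsJordanLoop (γ : ℝ → ℂ) : Prop :=
  ContinuousOn γ (Set.Icc 0 1) ∧ γ 0 = γ 1 ∧ Set.InjOn γ (Set.Ico 0 1)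

/-- A set is a finite union of horizontal and vertical closed segments in `ℂ`. -/
def FinUnionHV (S : Set ℂ) : Prop :=
  ∃ (n : ℕ) (p q : Fin n → ℂ),
    (∀ i, (p i).re = (q i).re ∨ (p i).im = (q i).im) ∧
    S = ⋃ i, segment ℝ (p i) (q i)

theorem cyc_reach {V : Type*} {G : SimpleGraph V} (hfin : G.support.Finite) (hc : G.IsCycles)
    {v w : V} (h : G.Adj v w) : (G.deleteEdges {s(v, w)}).Reachable v w := by
  classical
  set S := G.support with hS
  have : Finite S := hfin
  let H := G.induce S
  have hH : H.IsCycles := by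
    intro a ha
    have e : Subtype.val '' (H.neighborSet a) = G.neighborSet a := by
      ext b
      simp only [Set.mem_image, SimpleGraph.mem_neighborSet, Subtype.exists, exists_and_right,
        exists_eq_right]
      constructor
      · rintro ⟨hb, h1⟩
        exact h1
      · intro h1
        exact ⟨⟨_, h1.symm⟩, h1⟩
    rw [← Set.ncard_image_of_injective _ Subtype.val_injective, e]
    apply hc
    rw [← e]
    exact ha.image _
  have hv : v ∈ S := ⟨_, h⟩
  have hw : w ∈ S := ⟨_, h.symm⟩
  have h1 : H.Adj ⟨v, hv⟩ ⟨w, hw⟩ := h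
  have h2 := hH.reachable_deleteEdges h1
  let f : H.deleteEdges {s(⟨v, hv⟩, ⟨w, hw⟩)} →g G.deleteEdges {s(v, w)} :=
    ⟨Subtype.val, by
      rintro ⟨a, ha⟩ ⟨b, hb⟩ hab
      rw [SimpleGraph.deleteEdges_adj] at hab ⊢
      refine ⟨hab.1, ?_⟩
      simpa using hab.2⟩
  exact h2.map f

theorem cyc_exists {V : Type*} {G : SimpleGraph V} (hfin : G.support.Finite) (hc : G.IsCycles)
    {v w : V} (h : G.Adj v w) : ∃ (u : V) (p : G.Walk u u), p.IsCycle ∧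
      ∀ a b, G.Adj a b → G.Reachable v a → p.toSubgraph.Adj a b := by
  classical
  obtain ⟨u, p, hp, hvw⟩ := SimpleGraph.adj_and_reachable_delete_edges_iff_exists_cycle.mp
    ⟨h, cyc_reach hfin hc h⟩
  have hvp : v ∈ p.support := SimpleGraph.Walk.fst_mem_support_of_mem_edges _ hvw
  have key : ∀ a ∈ p.support, ∀ b, G.Adj a b → p.toSubgraph.Adj a b := by
    intro a ha b hab
    have h1 := hp.ncard_neighborSet_toSubgraph_eq_two ha
    have h2 := hc ⟨b, hab⟩
    have h3 := Set.eq_of_subset_of_ncard_le (p.toSubgraph.neighborSet_subset a) (by omega)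
      (Set.finite_of_ncard_ne_zero (by omega))
    have : b ∈ G.neighborSet a := hab
    rw [← h3] at this
    exact this
  refine ⟨u, p, hp, ?_⟩
  intro a b hab hr
  refine key a ?_ b hab
  obtain ⟨q⟩ := hr
  clear hab h hvw
  induction q with
  | nil => exact hvp
  | cons h q ih =>
    refine ih ?_
    exact p.mem_verts_toSubgraph.mp (key _ hvp _ h).snd_mem

/-- 2-switch -/
theorem switch {V : Type*} {G G' : SimpleGraph V} (hfin : G.support.Finite) (hc : G.IsCycles)
    {P Q R S v : V} (hRS : G.Adj R S)
    (hPR : G'.Adj P R) (hQS : G'.Adj Q S)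
    (hrest : ∀ a b, G.Adj a b → s(a, b) ≠ s(P, Q) → s(a, b) ≠ s(R, S) → G'.Adj a b)
    (hPQ : G.Adj P Q) (hP : G.Reachable v P) (hR : ¬ G.Reachable v R) :
    (∀ a, G.Reachable v a → G'.Reachable v a) ∧ G'.Reachable v R := by
  have h1 : G'.Reachable R S := by
    obtain ⟨q⟩ := cyc_reach hfin hc hRS
    have : ∀ a b, (G.deleteEdges {s(R, S)}).Walk a b → ¬ G.Reachable v a → G'.Reachable a b := by
      intro a b q
      induction q with
      | nil => intro _; rfl
      | @cons a b c hab q ih =>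
        intro ha
        rw [SimpleGraph.deleteEdges_adj] at hab
        have hb : ¬ G.Reachable v b := fun hb => ha (hb.trans hab.1.symm.reachable)
        refine SimpleGraph.Reachable.trans (SimpleGraph.Adj.reachable ?_) (ih hb)
        refine hrest _ _ hab.1 ?_ (by simpa using hab.2)
        intro he
        rw [Sym2.eq_iff] at he
        rcases he with ⟨rfl, rfl⟩ | ⟨rfl, rfl⟩
        · exact ha hP
        · exact hb hP
    exact this _ _ q hR
  have h2 : G'.Reachable P Q := hPR.reachable.trans (h1.trans hQS.symm.reachable)
  have h3 : ∀ a b, G.Walk a b → G.Reachable v a → G'.Reachable a b := by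
    intro a b q
    induction q with
    | nil => intro _; rfl
    | @cons a b c hab q ih =>
      intro ha
      have hb : G.Reachable v b := ha.trans hab.reachable
      refine SimpleGraph.Reachable.trans ?_ (ih hb)
      by_cases he : s(a, b) = s(P, Q)
      · rw [Sym2.eq_iff] at he
        rcases he with ⟨rfl, rfl⟩ | ⟨rfl, rfl⟩
        · exact h2
        · exact h2.symm
      · refine SimpleGraph.Adj.reachable (hrest _ _ hab he ?_)
        intro he
        rw [Sym2.eq_iff] at he
        rcases he with ⟨rfl, rfl⟩ | ⟨rfl, rfl⟩
        · exact hR ha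
        · exact hR hb
  have h4 : ∀ a, G.Reachable v a → G'.Reachable v a := by
    rintro a ⟨q⟩
    exact h3 _ _ q (SimpleGraph.Reachable.refl _)
  exact ⟨h4, (h4 P hP).trans hPR.reachable⟩

/-- boundary graph of a colouring -/
def bG (c : ℤ → ℤ → Bool) : SimpleGraph (ℤ × ℤ) where
  Adj u v := (u.2 = v.2 ∧ v.1 = u.1 + 1 ∧ c u.1 u.2 ≠ c u.1 (u.2 - 1)) ∨
    (u.2 = v.2 ∧ u.1 = v.1 + 1 ∧ c v.1 v.2 ≠ c v.1 (v.2 - 1)) ∨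
    (u.1 = v.1 ∧ v.2 = u.2 + 1 ∧ c u.1 u.2 ≠ c (u.1 - 1) u.2) ∨
    (u.1 = v.1 ∧ u.2 = v.2 + 1 ∧ c v.1 v.2 ≠ c (v.1 - 1) v.2)
  symm := ⟨by rintro ⟨a, b⟩ ⟨a', b'⟩ h; simp only at h ⊢; grind⟩
  loopless := ⟨by rintro ⟨a, b⟩ h; simp only at h; grind⟩

theorem bG_adj (c : ℤ → ℤ → Bool) (u v : ℤ × ℤ) : (bG c).Adj u v ↔
    (u.2 = v.2 ∧ v.1 = u.1 + 1 ∧ c u.1 u.2 ≠ c u.1 (u.2 - 1)) ∨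
    (u.2 = v.2 ∧ u.1 = v.1 + 1 ∧ c v.1 v.2 ≠ c v.1 (v.2 - 1)) ∨
    (u.1 = v.1 ∧ v.2 = u.2 + 1 ∧ c u.1 u.2 ≠ c (u.1 - 1) u.2) ∨
    (u.1 = v.1 ∧ u.2 = v.2 + 1 ∧ c v.1 v.2 ≠ c (v.1 - 1) v.2) := Iff.rfl

theorem bG_h (c : ℤ → ℤ → Bool) (x y : ℤ) :
    (bG c).Adj (x, y) (x + 1, y) ↔ c x y ≠ c x (y - 1) := by
  rw [bG_adj]; simp only; grind

theorem bG_v (c : ℤ → ℤ → Bool) (x y : ℤ) :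
    (bG c).Adj (x, y) (x, y + 1) ↔ c x y ≠ c (x - 1) y := by
  rw [bG_adj]; simp only; grind

theorem bG_nb (c : ℤ → ℤ → Bool) (x y : ℤ) (w : ℤ × ℤ) : (bG c).Adj (x, y) w ↔
    (w = (x + 1, y) ∧ c x y ≠ c x (y - 1)) ∨
    (w = (x - 1, y) ∧ c (x - 1) y ≠ c (x - 1) (y - 1)) ∨
    (w = (x, y + 1) ∧ c x y ≠ c (x - 1) y) ∨
    (w = (x, y - 1) ∧ c x (y - 1) ≠ c (x - 1) (y - 1)) := by
  obtain ⟨a, b⟩ := w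
  rw [bG_adj]; simp only [Prod.mk.injEq]; grind

def NoChk (c : ℤ → ℤ → Bool) : Prop :=
  ∀ x y, c x y = c (x - 1) (y - 1) → c (x - 1) y = c x (y - 1) → c x y = c (x - 1) y

theorem bG_cycles (c : ℤ → ℤ → Bool) (hc : NoChk c) : (bG c).IsCycles := by
  rintro ⟨x, y⟩ ⟨w, hw⟩
  have h := hc x y
  have key : ∃ a b : ℤ × ℤ, a ≠ b ∧ (bG c).neighborSet (x, y) = {a, b} := by
    rw [SimpleGraph.mem_neighborSet, bG_nb] at hw
    have e : ∀ w, w ∈ (bG c).neighborSet (x, y) ↔ _ := fun w => bG_nb c x y w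
    simp only [Set.ext_iff, e, Set.mem_insert_iff, Set.mem_singleton_iff]
    clear e
    have n1 : (x + 1, y) ≠ (x - 1, y) := by simp; omega
    have n2 : (x + 1, y) ≠ (x, y + 1) := by simp
    have n3 : (x + 1, y) ≠ (x, y - 1) := by simp
    have n4 : (x - 1, y) ≠ (x, y + 1) := by simp
    have n5 : (x - 1, y) ≠ (x, y - 1) := by simp
    have n6 : (x, y + 1) ≠ (x, y - 1) := by simp; omega
    revert h hw
    generalize c x y = p
    generalize c x (y - 1) = q
    generalize c (x - 1) y = r
    generalize c (x - 1) (y - 1) = s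
    generalize (x + 1, y) = A at *
    generalize (x - 1, y) = B at *
    generalize (x, y + 1) = C at *
    generalize (x, y - 1) = D at *
    intro hw h
    cases p <;> cases q <;> cases r <;> cases s <;> simp [-Prod.exists, -Prod.forall] at hw h ⊢
    · exact ⟨B, D, n5, fun _ => by simp⟩
    · exact ⟨B, C, n4, fun _ => by simp⟩
    · exact ⟨C, D, n6, fun _ => by simp⟩
    · exact ⟨A, D, n3, fun _ => by simp⟩
    · exact ⟨A, B, n1, fun _ => by simp⟩
    · exact ⟨A, C, n2, fun _ => by simp⟩
    · exact ⟨A, C, n2, fun _ => by simp⟩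
    · exact ⟨A, B, n1, fun _ => by simp⟩
    · exact ⟨A, D, n3, fun _ => by simp⟩
    · exact ⟨C, D, n6, fun _ => by simp⟩
    · exact ⟨B, C, n4, fun _ => by simp⟩
    · exact ⟨B, D, n5, fun _ => by simp⟩
  obtain ⟨a, b, hab, h2⟩ := key
  rw [h2, Set.ncard_pair hab]

theorem bG_supp (c : ℤ → ℤ → Bool) (N : ℤ)
    (hN : ∀ x y, c x y = true → -N ≤ x ∧ x ≤ N ∧ -N ≤ y ∧ y ≤ N) :
    (bG c).support ⊆ Set.Icc (-(N + 1)) (N + 1) ×ˢ Set.Icc (-(N + 1)) (N + 1) := by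
  rintro ⟨x, y⟩ ⟨w, hw⟩
  replace hw : (bG c).Adj (x, y) w := hw
  rw [bG_nb] at hw
  have h1 := hN x y
  have h2 := hN (x - 1) y
  have h3 := hN x (y - 1)
  have h4 := hN (x - 1) (y - 1)
  have : c x y = true ∨ c (x-1) y = true ∨ c x (y-1) = true ∨ c (x-1) (y-1) = true := by
    by_contra hcon
    simp only [not_or, Bool.not_eq_true] at hcon
    simp [hcon] at hw
  simp only [Set.mem_prod, Set.mem_Icc]
  grind

theorem gridswitch (c c' : ℤ → ℤ → Bool) (x y : ℤ) (hfin : (bG c).support.Finite) (hc : NoChk c)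
    (h0 : ∀ x' y', ¬ (x' = x ∧ y' = y) → c' x' y' = c x' y') (h1 : c' x y = !(c x y))
    (l : Bool) (hl : c (x - 1) y = l) (hr : c (x + 1) y = l) (hb : c x (y - 1) = !l)
    (ht : c x (y + 1) = !l) (v : ℤ × ℤ)
    (hv : ∃ i j : ℤ, (i = x ∨ i = x + 1) ∧ (j = y ∨ j = y + 1) ∧ (bG c).Reachable v (i, j))
    (hv' : ∃ i j : ℤ, (i = x ∨ i = x + 1) ∧ (j = y ∨ j = y + 1) ∧ ¬ (bG c).Reachable v (i, j)) :
    (∀ a, (bG c).Reachable v a → (bG c').Reachable v a) ∧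
    ∃ b, ¬ (bG c).Reachable v b ∧ (bG c').Reachable v b := by
  have hcyc := bG_cycles c hc
  have L := bG_v c x y
  have Rr := bG_v c (x + 1) y
  have B := bG_h c x y
  have T := bG_h c x (y + 1)
  have L' := bG_v c' x y
  have R' := bG_v c' (x + 1) y
  have B' := bG_h c' x y
  have T' := bG_h c' x (y + 1)
  have e1 := h0 (x - 1) y (by omega)
  have e2 := h0 (x + 1) y (by omega)
  have e3 := h0 x (y - 1) (by omega)
  have e4 := h0 x (y + 1) (by omega)
  rw [add_sub_cancel_right] at Rr T R' T'
  rw [h1, e1, hl] at L'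
  rw [h1, e2, hr] at R'
  rw [h1, e3, hb] at B'
  rw [h1, e4, ht] at T'
  rw [hl] at L
  rw [hr] at Rr
  rw [hb] at B
  rw [ht] at T
  have rest : ∀ a b, (bG c).Adj a b → s(a, b) ≠ s((x, y), (x, y + 1)) →
      s(a, b) ≠ s((x + 1, y), (x + 1, y + 1)) → s(a, b) ≠ s((x, y), (x + 1, y)) →
      s(a, b) ≠ s((x, y + 1), (x + 1, y + 1)) → (bG c').Adj a b := by
    rintro ⟨a1, a2⟩ ⟨b1, b2⟩ hab n1 n2 n3 n4
    simp only [ne_eq, Sym2.eq_iff, Prod.mk.injEq] at n1 n2 n3 n4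
    rw [bG_adj] at hab ⊢
    simp only at hab ⊢
    rcases hab with hab | hab | hab | hab
    · left
      obtain ⟨rfl, rfl, hab⟩ := hab
      rw [h0 _ _ (by omega), h0 _ _ (by omega)]
      simp [hab]
    · right; left
      obtain ⟨rfl, rfl, hab⟩ := hab
      rw [h0 _ _ (by omega), h0 _ _ (by omega)]
      simp [hab]
    · right; right; left
      obtain ⟨rfl, rfl, hab⟩ := hab
      rw [h0 _ _ (by omega), h0 _ _ (by omega)]
      simp [hab]
    · right; right; right
      obtain ⟨rfl, rfl, hab⟩ := hab
      rw [h0 _ _ (by omega), h0 _ _ (by omega)]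
      simp [hab]
  by_cases hcl : c x y = l
  · have nL : ¬ (bG c).Adj (x, y) (x, y + 1) := by rw [L]; simp [hcl]
    have nR : ¬ (bG c).Adj (x + 1, y) (x + 1, y + 1) := by rw [Rr]; simp [hcl]
    have aB : (bG c).Adj (x, y) (x + 1, y) := by rw [B]; simp [hcl]
    have aT : (bG c).Adj (x, y + 1) (x + 1, y + 1) := by rw [T]; simp [hcl]
    have aL : (bG c').Adj (x, y) (x, y + 1) := by rw [L']; simp [hcl]
    have aR : (bG c').Adj (x + 1, y) (x + 1, y + 1) := by rw [R']; simp [hcl]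
    have rest' : ∀ a b, (bG c).Adj a b → s(a, b) ≠ s((x, y), (x + 1, y)) →
      s(a, b) ≠ s((x, y + 1), (x + 1, y + 1)) → (bG c').Adj a b := by
      intro a b hab n3 n4
      refine rest a b hab ?_ ?_ n3 n4
      · intro he; rw [← SimpleGraph.mem_edgeSet, he] at hab; exact nL hab
      · intro he; rw [← SimpleGraph.mem_edgeSet, he] at hab; exact nR hab
    by_cases hb : (bG c).Reachable v (x, y)
    · have hb2 := hb.trans aB.reachable
      have ht : ¬ (bG c).Reachable v (x, y + 1) := by
        intro ht
        have ht2 := ht.trans aT.reachable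
        obtain ⟨i, j, rfl | rfl, rfl | rfl, h⟩ := hv' <;> exact h (by assumption)
      have := switch hfin hcyc aT aL aR rest' aB hb ht
      exact ⟨this.1, _, ht, this.2⟩
    · have hb2 : ¬ (bG c).Reachable v (x + 1, y) := fun h => hb (h.trans aB.symm.reachable)
      have ht : (bG c).Reachable v (x, y + 1) := by
        by_contra ht
        have ht2 : ¬ (bG c).Reachable v (x + 1, y + 1) := fun h => ht (h.trans aT.symm.reachable)
        obtain ⟨i, j, rfl | rfl, rfl | rfl, h⟩ := hv <;> contradiction
      have := switch hfin hcyc aB aL.symm aR.symm (fun a b h h1 h2 => rest' a b h h2 h1) aT ht hb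
      exact ⟨this.1, _, hb, this.2⟩
  · have hcl : c x y = !l := by revert hcl; cases c x y <;> cases l <;> simp
    have nB : ¬ (bG c).Adj (x, y) (x + 1, y) := by rw [B]; simp [hcl]
    have nT : ¬ (bG c).Adj (x, y + 1) (x + 1, y + 1) := by rw [T]; simp [hcl]
    have aL : (bG c).Adj (x, y) (x, y + 1) := by rw [L]; simp [hcl]
    have aR : (bG c).Adj (x + 1, y) (x + 1, y + 1) := by rw [Rr]; simp [hcl]
    have aB : (bG c').Adj (x, y) (x + 1, y) := by rw [B']; simp [hcl]
    have aT : (bG c').Adj (x, y + 1) (x + 1, y + 1) := by rw [T']; simp [hcl]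
    have rest' : ∀ a b, (bG c).Adj a b → s(a, b) ≠ s((x, y), (x, y + 1)) →
      s(a, b) ≠ s((x + 1, y), (x + 1, y + 1)) → (bG c').Adj a b := by
      intro a b hab n3 n4
      refine rest a b hab n3 n4 ?_ ?_
      · intro he; rw [← SimpleGraph.mem_edgeSet, he] at hab; exact nB hab
      · intro he; rw [← SimpleGraph.mem_edgeSet, he] at hab; exact nT hab
    by_cases hb : (bG c).Reachable v (x, y)
    · have hb2 := hb.trans aL.reachable
      have ht : ¬ (bG c).Reachable v (x + 1, y) := by
        intro ht
        have ht2 := ht.trans aR.reachable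
        obtain ⟨i, j, rfl | rfl, rfl | rfl, h⟩ := hv' <;> exact h (by assumption)
      have := switch hfin hcyc aR aB aT rest' aL hb ht
      exact ⟨this.1, _, ht, this.2⟩
    · have hb2 : ¬ (bG c).Reachable v (x, y + 1) := fun h => hb (h.trans aL.symm.reachable)
      have ht : (bG c).Reachable v (x + 1, y) := by
        by_contra ht
        have ht2 : ¬ (bG c).Reachable v (x + 1, y + 1) := fun h => ht (h.trans aR.symm.reachable)
        obtain ⟨i, j, rfl | rfl, rfl | rfl, h⟩ := hv <;> contradiction
      have := switch hfin hcyc aL aB.symm aT.symm (fun a b h h1 h2 => rest' a b h h2 h1) aR ht hb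
      exact ⟨this.1, _, hb, this.2⟩

def hasF (Fr : Set (ℤ × ℤ)) (x y : ℤ) : Prop :=
  (x + 1, y) ∈ Fr ∨ (x - 1, y) ∈ Fr ∨ (x, y + 1) ∈ Fr ∨ (x, y - 1) ∈ Fr

def nbs (x y : ℤ) : Set (ℤ × ℤ) := {(x + 1, y), (x - 1, y), (x, y + 1), (x, y - 1)}

theorem mem_nbs (x y : ℤ) (p : ℤ × ℤ) : p ∈ nbs x y ↔
  p = (x + 1, y) ∨ p = (x - 1, y) ∨ p = (x, y + 1) ∨ p = (x, y - 1) := Iff.rfl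

theorem hasF_iff (Fr : Set (ℤ × ℤ)) (x y : ℤ) : hasF Fr x y ↔ ∃ p ∈ nbs x y, p ∈ Fr := by
  simp [hasF, nbs]

open Classical in
noncomputable def col (Fr Eo : Set (ℤ × ℤ)) (T : ℤ × ℤ → Bool) (x y : ℤ) : Bool :=
  if (x + y) % 2 = 1 then (if (x, y) ∈ Fr then T (x, y) else decide ((x, y) ∈ Eo))
  else if hasF Fr x y then decide (x % 2 = 0) else decide ((x + 1, y) ∈ Eo)

def SepC (Fr Eo : Set (ℤ × ℤ)) : Prop := ∀ x y : ℤ, (x + y) % 2 = 0 →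
  ∀ a ∈ nbs x y, ∀ b ∈ nbs x y, a ∉ Fr → b ∉ Fr → (a ∈ Eo ↔ b ∈ Eo)

theorem nbs_odd {x y : ℤ} (h : (x + y) % 2 = 0) {a b : ℤ} (hp : (a, b) ∈ nbs x y) :
    (a + b) % 2 = 1 := by
  simp only [mem_nbs, Prod.mk.injEq] at hp
  omega

theorem col_nofree {Fr Eo : Set (ℤ × ℤ)} (hs : SepC Fr Eo) (T : ℤ × ℤ → Bool) {x y : ℤ}
    (h : (x + y) % 2 = 0) (hf : ¬ hasF Fr x y) {a b : ℤ} (hp : (a, b) ∈ nbs x y) :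
    col Fr Eo T a b = col Fr Eo T x y := by
  have h1 : (a, b) ∉ Fr := fun h => hf ((hasF_iff _ _ _).2 ⟨_, hp, h⟩)
  have hm : (x + 1, y) ∈ nbs x y := by simp [nbs]
  have h2 : (x + 1, y) ∉ Fr := fun h => hf ((hasF_iff _ _ _).2 ⟨_, hm, h⟩)
  have := hs x y h _ hp _ hm h1 h2
  have hab := nbs_odd h hp
  have h' : ¬ (x + y) % 2 = 1 := by omega
  simp [col, hab, h1, h', hf, this]

theorem col_nochk {Fr Eo : Set (ℤ × ℤ)} (hs : SepC Fr Eo) (T : ℤ × ℤ → Bool) :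
    NoChk (col Fr Eo T) := by
  intro x y h1 h2
  by_cases h : (x + y) % 2 = 0
  · have h' : (x - 1 + (y - 1)) % 2 = 0 := by omega
    by_cases f1 : hasF Fr x y
    · by_cases f2 : hasF Fr (x - 1) (y - 1)
      · have g : ¬ (x + y) % 2 = 1 := by omega
        have g' : ¬ (x - 1 + (y - 1)) % 2 = 1 := by omega
        simp only [col, g, g', f1, f2, if_true, if_false, decide_eq_decide] at h1
        omega
      · have := col_nofree hs T h' f2 (a := x - 1) (b := y) (by simp [nbs])
        rw [this, h1]
    · exact (col_nofree hs T h f1 (a := x - 1) (b := y) (by simp [nbs])).symm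
  · have h3 : (x - 1 + y) % 2 = 0 := by omega
    have h4 : (x + (y - 1)) % 2 = 0 := by omega
    by_cases f1 : hasF Fr (x - 1) y
    · by_cases f2 : hasF Fr x (y - 1)
      · have g : ¬ (x - 1 + y) % 2 = 1 := by omega
        have g' : ¬ (x + (y - 1)) % 2 = 1 := by omega
        simp only [col, g, g', f1, f2, if_true, if_false, decide_eq_decide] at h2
        omega
      · have := col_nofree hs T h4 f2 (a := x) (b := y) (by simp [nbs])
        rw [this, h2]
    · exact (col_nofree hs T h3 f1 (a := x) (b := y) (by simp [nbs]))

theorem col_bdd {Fr Eo : Set (ℤ × ℤ)} (N : ℤ)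
    (hF : ∀ p ∈ Fr, -N ≤ p.1 ∧ p.1 ≤ N ∧ -N ≤ p.2 ∧ p.2 ≤ N)
    (hE : ∀ p ∈ Eo, -N ≤ p.1 ∧ p.1 ≤ N ∧ -N ≤ p.2 ∧ p.2 ≤ N) (T : ℤ × ℤ → Bool) (x y : ℤ)
    (h : col Fr Eo T x y = true) :
    -(N + 1) ≤ x ∧ x ≤ N + 1 ∧ -(N + 1) ≤ y ∧ y ≤ N + 1 := by
  classical
  unfold col at h
  split_ifs at h with h1 h2 h3
  · have := hF _ h2
    simp only at this; omega
  · have := hE _ (by simpa using h)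
    simp only at this; omega
  · rcases h3 with h3 | h3 | h3 | h3 <;> have := hF _ h3 <;> simp only at this <;> omega
  · have := hE _ (by simpa using h)
    simp only at this; omega

def Diag (p q : ℤ × ℤ) : Prop :=
  (q.1 = p.1 + 1 ∨ q.1 = p.1 - 1) ∧ (q.2 = p.2 + 1 ∨ q.2 = p.2 - 1)

theorem discrete (Fr Eo : Set (ℤ × ℤ)) (hs : SepC Fr Eo) (N : ℤ)
    (hodd : ∀ p ∈ Fr, (p.1 + p.2) % 2 = 1)
    (hF : ∀ p ∈ Fr, -N ≤ p.1 ∧ p.1 ≤ N ∧ -N ≤ p.2 ∧ p.2 ≤ N)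
    (hE : ∀ p ∈ Eo, -N ≤ p.1 ∧ p.1 ≤ N ∧ -N ≤ p.2 ∧ p.2 ≤ N)
    (p0 : ℤ × ℤ) (hp0 : p0 ∈ Fr)
    (hconn : ∀ P : ℤ × ℤ → Prop, P p0 → (∀ p ∈ Fr, ∀ q ∈ Fr, Diag p q → P p → P q) →
      ∀ p ∈ Fr, P p) :
    ∃ T : ℤ × ℤ → Bool, (∃ w, (bG (col Fr Eo T)).Adj p0 w) ∧
      ∀ a b, (bG (col Fr Eo T)).Adj a b → (bG (col Fr Eo T)).Reachable p0 a := by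
  classical
  set G : (ℤ × ℤ → Bool) → SimpleGraph (ℤ × ℤ) := fun T => bG (col Fr Eo T) with hG
  set B : Set (ℤ × ℤ) := Set.Icc (-(N + 2)) (N + 2) ×ˢ Set.Icc (-(N + 2)) (N + 2) with hB
  have hBfin : B.Finite := (Set.finite_Icc _ _).prod (Set.finite_Icc _ _)
  have hsup : ∀ T, (G T).support ⊆ B := by
    intro T
    have := bG_supp _ _ (col_bdd N hF hE T)
    rw [show N + 1 + 1 = N + 2 by ring] at this
    exact this
  have hp0B : p0 ∈ B := by
    have := hF _ hp0
    simp only [hB, Set.mem_prod, Set.mem_Icc]; omega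
  have hreach : ∀ T, {a | (G T).Reachable p0 a} ⊆ B := by
    rintro T a ha
    by_cases h : a = p0
    · rw [h]; exact hp0B
    · obtain ⟨q⟩ := (ha : (G T).Reachable p0 a).symm
      cases q with
      | nil => exact absurd rfl h
      | cons h1 q => exact hsup T ⟨_, h1⟩
  -- colours around a free cell
  have hcell : ∀ T, ∀ x y, (x, y) ∈ Fr →
      col Fr Eo T (x - 1) y = decide ((x + 1) % 2 = 0) ∧
      col Fr Eo T (x + 1) y = decide ((x + 1) % 2 = 0) ∧
      col Fr Eo T x (y - 1) = !decide ((x + 1) % 2 = 0) ∧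
      col Fr Eo T x (y + 1) = !decide ((x + 1) % 2 = 0) := by
    intro T x y h
    have ho := hodd _ h
    simp only at ho
    have f1 : hasF Fr (x - 1) y := by left; simpa using h
    have f2 : hasF Fr (x + 1) y := by right; left; simpa using h
    have f3 : hasF Fr x (y - 1) := by right; right; left; simpa using h
    have f4 : hasF Fr x (y + 1) := by right; right; right; simpa using h
    have g1 : ¬ (x - 1 + y) % 2 = 1 := by omega
    have g2 : ¬ (x + 1 + y) % 2 = 1 := by omega
    have g3 : ¬ (x + (y - 1)) % 2 = 1 := by omega
    have g4 : ¬ (x + (y + 1)) % 2 = 1 := by omega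
    simp only [col, f1, f2, f3, f4, g1, g2, g3, g4, if_true, if_false]
    rw [← decide_not]
    simp only [decide_eq_decide]
    refine ⟨?_, ?_, ?_, ?_⟩ <;> (try trivial) <;> omega
  -- choose T maximal
  obtain ⟨T, -, hT⟩ := WellFounded.has_min
    (measure fun T : ℤ × ℤ → Bool => B.ncard - {a | (G T).Reachable p0 a}.ncard).wf Set.univ
    ⟨fun _ => true, trivial⟩
  have hmax : ∀ T', {a | (G T').Reachable p0 a}.ncard ≤ {a | (G T).Reachable p0 a}.ncard := by
    intro T'
    have h1 := hT T' trivial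
    have h2 := Set.ncard_le_ncard (hreach T') hBfin
    have h3 := Set.ncard_le_ncard (hreach T) hBfin
    replace h1 : ¬ (B.ncard - {a | (G T').Reachable p0 a}.ncard <
      B.ncard - {a | (G T).Reachable p0 a}.ncard) := h1
    omega
  have hall : ∀ x y, (x, y) ∈ Fr →
    (∃ i j : ℤ, (i = x ∨ i = x + 1) ∧ (j = y ∨ j = y + 1) ∧ (G T).Reachable p0 (i, j)) →
    ∀ i j : ℤ, (i = x ∨ i = x + 1) → (j = y ∨ j = y + 1) → (G T).Reachable p0 (i, j) := by
    intro x y hxy hv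
    by_contra! hv'
    obtain ⟨c1, c2, c3, c4⟩ := hcell T x y hxy
    have ho := hodd _ hxy
    simp only at ho
    have := gridswitch (col Fr Eo T) (col Fr Eo (Function.update T (x, y) (!T (x, y)))) x y
      (hBfin.subset (hsup T)) (col_nochk hs T) (by
        intro x' y' hne
        have : ¬ ((x', y') = (x, y)) := by simpa using hne
        simp [col, Function.update, this]) (by simp [col, ho, hxy]) _ c1 c2 c3 c4 p0 hv hv'
    obtain ⟨h1, b, h2, h3⟩ := this
    have h4 := hmax (Function.update T (x, y) (!T (x, y)))
    have h5 := Set.ncard_lt_ncard (s := {a | (G T).Reachable p0 a})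
      (t := {a | (G (Function.update T (x, y) (!T (x, y)))).Reachable p0 a})
      ⟨fun a ha => h1 a ha, fun h => h2 (h h3)⟩ (hBfin.subset (hreach _))
    omega
  have hfree : ∀ p ∈ Fr, ∀ i j : ℤ, (i = p.1 ∨ i = p.1 + 1) → (j = p.2 ∨ j = p.2 + 1) →
      (G T).Reachable p0 (i, j) := by
    apply hconn
    · exact hall p0.1 p0.2 hp0 ⟨p0.1, p0.2, Or.inl rfl, Or.inl rfl, SimpleGraph.Reachable.refl _⟩
    · rintro ⟨x, y⟩ hp ⟨x', y'⟩ hq hd ih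
      refine hall x' y' hq ?_
      obtain ⟨h1, h2⟩ := hd
      simp only at h1 h2 ih
      refine ⟨if x' = x + 1 then x + 1 else x, if y' = y + 1 then y + 1 else y, ?_, ?_, ?_⟩
      · split_ifs <;> omega
      · split_ifs <;> omega
      · apply ih <;> split_ifs <;> omega
  -- around an even cell
  have heven : ∀ x y, (x + y) % 2 = 0 → ∀ a b, (a, b) ∈ nbs x y → (a, b) ∉ Fr →
      col Fr Eo T x y ≠ col Fr Eo T a b →
      ∀ i j : ℤ, (i = x ∨ i = x + 1) → (j = y ∨ j = y + 1) → (G T).Reachable p0 (i, j) := by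
    intro x y hev a b hab hfab hne
    have hf : hasF Fr x y := by
      by_contra hf
      exact hne (col_nofree hs T hev hf hab).symm
    have hcols : ∀ a' b', (a', b') ∈ nbs x y → (a', b') ∉ Fr →
        col Fr Eo T x y ≠ col Fr Eo T a' b' := by
      intro a' b' hab' hfab'
      have h1 := nbs_odd hev hab
      have h2 := nbs_odd hev hab'
      have h3 := hs x y hev _ hab _ hab' hfab hfab'
      have : col Fr Eo T a' b' = col Fr Eo T a b := by
        simp [col, h1, h2, hfab, hfab', h3]
      rw [this]; exact hne
    have side : ∀ a' b' i j i' j', (a', b') ∈ nbs x y →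
        (i = a' ∨ i = a' + 1) → (j = b' ∨ j = b' + 1) →
        (i' = a' ∨ i' = a' + 1) → (j' = b' ∨ j' = b' + 1) →
        (col Fr Eo T x y ≠ col Fr Eo T a' b' → (G T).Adj (i, j) (i', j')) →
        ((a', b') ∈ Fr → (G T).Reachable p0 (i, j)) ∧
        ((G T).Reachable p0 (i, j) ↔ (G T).Reachable p0 (i', j')) := by
      intro a' b' i j i' j' hm hi hj hi' hj' hadj
      by_cases h : (a', b') ∈ Fr
      · have h1 := hfree _ h i j hi hj
        have h2 := hfree _ h i' j' hi' hj'
        exact ⟨fun _ => h1, by simp [h1, h2]⟩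
      · have h1 := hadj (hcols _ _ hm h)
        exact ⟨fun h' => absurd h' h, fun h => h.trans h1.reachable,
          fun h => h.trans h1.symm.reachable⟩
    have sR := side (x + 1) y (x + 1) y (x + 1) (y + 1) (by simp [nbs]) (by simp) (by simp)
      (by simp) (by simp) (by
        intro h; rw [hG]; simp only; rw [bG_v]; simpa using h.symm)
    have sL := side (x - 1) y x y x (y + 1) (by simp [nbs]) (by simp) (by simp)
      (by simp) (by simp) (by
        intro h; rw [hG]; simp only; rw [bG_v]; exact h)
    have sT := side x (y + 1) x (y + 1) (x + 1) (y + 1) (by simp [nbs]) (by simp) (by simp)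
      (by simp) (by simp) (by
        intro h; rw [hG]; simp only; rw [bG_h]; simpa using h.symm)
    have sB := side x (y - 1) x y (x + 1) y (by simp [nbs]) (by simp) (by simp)
      (by simp) (by simp) (by
        intro h; rw [hG]; simp only; rw [bG_h]; exact h)
    intro i j hi hj
    unfold hasF at hf
    have h00 : (G T).Reachable p0 (x, y) := by
      rcases hf with h | h | h | h
      · exact sB.2.2 (sR.1 h)
      · exact sL.1 h
      · exact sL.2.2 (sT.1 h)
      · exact sB.1 h
    have h10 := sB.2.1 h00
    have h01 := sL.2.1 h00
    have h11 := sR.2.1 h10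
    rcases hi with rfl | rfl <;> rcases hj with rfl | rfl <;> assumption
  have hedge : ∀ x y a b, (a, b) ∈ nbs x y → col Fr Eo T x y ≠ col Fr Eo T a b →
      ∀ i j : ℤ, (i = x ∨ i = x + 1) → (j = y ∨ j = y + 1) → (i = a ∨ i = a + 1) →
      (j = b ∨ j = b + 1) → (G T).Reachable p0 (i, j) := by
    intro x y a b hab hne i j hi hj hi' hj'
    by_cases hev : (x + y) % 2 = 0
    · by_cases hfab : (a, b) ∈ Fr
      · exact hfree _ hfab _ _ hi' hj'
      · exact heven x y hev a b hab hfab hne i j hi hj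
    · by_cases hfab : (x, y) ∈ Fr
      · exact hfree _ hfab _ _ hi hj
      · refine heven a b ?_ x y ?_ hfab hne.symm i j hi' hj'
        · simp only [mem_nbs, Prod.mk.injEq] at hab; omega
        · simp only [mem_nbs, Prod.mk.injEq] at hab ⊢; omega
  refine ⟨T, ?_⟩
  constructor
  · obtain ⟨x, y⟩ := p0
    obtain ⟨c1, c2, c3, c4⟩ := hcell T x y hp0
    by_cases h : col Fr Eo T x y = col Fr Eo T (x - 1) y
    · refine ⟨(x + 1, y), ?_⟩
      rw [bG_h, h, c1, c3]
      cases decide ((x + 1) % 2 = 0) <;> simp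
    · exact ⟨(x, y + 1), (bG_v _ _ _).2 h⟩
  · rintro ⟨i, j⟩ w hw
    rw [bG_nb] at hw
    rcases hw with hw | hw | hw | hw
    · exact hedge _ _ _ _ (by simp [nbs]) hw.2 i j (by simp) (by simp) (by simp) (by simp)
    · exact hedge _ _ _ _ (by simp [nbs]) hw.2 i j (by simp) (by simp) (by simp) (by simp)
    · exact hedge _ _ _ _ (by simp [nbs]) hw.2 i j (by simp) (by simp) (by simp) (by simp)
    · exact hedge _ _ _ _ (by simp [nbs]) hw.2 i j (by simp) (by simp) (by simp) (by simp)

def pos (h : ℝ) (q : ℤ × ℤ) : ℂ := ⟨h * q.1, h * q.2⟩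

noncomputable def plf (z : ℕ → ℂ) (n : ℕ) (s : ℝ) : ℂ :=
  z 0 + ∑ k ∈ Finset.range n, ((max 0 (min 1 (s - k)) : ℝ) : ℂ) * (z (k + 1) - z k)

theorem plf_cont (z : ℕ → ℂ) (n : ℕ) : Continuous (plf z n) := by
  unfold plf; fun_prop

theorem plf_eq (z : ℕ → ℂ) (n m : ℕ) (hm : m < n) (s : ℝ) (h1 : (m : ℝ) ≤ s) (h2 : s ≤ m + 1) :
    plf z n s = z m + ((s - m : ℝ) : ℂ) * (z (m + 1) - z m) := by
  obtain ⟨r, rfl⟩ : ∃ r, n = m + 1 + r := ⟨n - (m + 1), by omega⟩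
  unfold plf
  rw [Finset.sum_range_add, Finset.sum_range_succ]
  have e1 : ∑ k ∈ Finset.range m, ((max 0 (min 1 (s - k)) : ℝ) : ℂ) * (z (k + 1) - z k)
      = z m - z 0 := by
    rw [← Finset.sum_range_sub]
    refine Finset.sum_congr rfl fun k hk => ?_
    have hk : k + 1 ≤ m := Finset.mem_range.1 hk
    have hk' : (k : ℝ) + 1 ≤ m := by exact_mod_cast hk
    rw [min_eq_left (by linarith), max_eq_right (by norm_num)]
    simp
  have e2 : ∑ k ∈ Finset.range r, ((max 0 (min 1 (s - (m + 1 + k : ℕ))) : ℝ) : ℂ) *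
      (z (m + 1 + k + 1) - z (m + 1 + k)) = 0 := by
    refine Finset.sum_eq_zero fun k hk => ?_
    have : s - ((m + 1 + k : ℕ) : ℝ) ≤ 0 := by
      push_cast
      have : (0 : ℝ) ≤ k := Nat.cast_nonneg k
      linarith
    rw [max_eq_left ((min_le_right _ _).trans this)]
    simp
  rw [e1, e2, min_eq_right (by linarith), max_eq_right (by linarith)]
  ring

theorem one_dim (a a' d d' : ℤ) (u u' : ℝ) (hu : 0 ≤ u) (hu1 : u < 1) (hu' : 0 ≤ u')
    (hu1' : u' < 1) (hd : d = 1 ∨ d = -1 ∨ d = 0) (hd' : d' = 1 ∨ d' = -1 ∨ d' = 0)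
    (h : (a : ℝ) + u * d = a' + u' * d') :
    (d = 0 ∧ d' = 0 ∧ a = a') ∨ (d = 0 ∧ d' ≠ 0 ∧ u' = 0 ∧ a = a') ∨
    (d ≠ 0 ∧ d' = 0 ∧ u = 0 ∧ a = a') ∨ (d ≠ 0 ∧ d = d' ∧ u = u' ∧ a = a') ∨
    (d ≠ 0 ∧ d = -d' ∧ u = 0 ∧ u' = 0 ∧ a = a') ∨ (d ≠ 0 ∧ d = -d' ∧ a' = a + d) := by
  have k0 : ∀ k : ℤ, (-1 : ℝ) < k → (k : ℝ) < 1 → k = 0 := by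
    intro k h1 h2
    have h1 : (-1 : ℤ) < k := by exact_mod_cast h1
    have h2 : k < 1 := by exact_mod_cast h2
    omega
  have k1 : ∀ k : ℤ, (0 : ℝ) < k → (k : ℝ) < 2 → k = 1 := by
    intro k h1 h2
    have h1 : (0 : ℤ) < k := by exact_mod_cast h1
    have h2 : k < 2 := by exact_mod_cast h2
    omega
  have hk0 : ∀ t : ℝ, -1 < t → t < 1 → (a' : ℝ) - a = t → a = a' ∧ t = 0 := by
    intro t h1 h2 h3
    have := k0 (a' - a) (by push_cast; linarith) (by push_cast; linarith)
    have e : a = a' := by omega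
    refine ⟨e, ?_⟩
    rw [← h3, e]; ring
  rcases hd with rfl | rfl | rfl <;> rcases hd' with rfl | rfl | rfl <;>
    simp only [Int.cast_one, Int.cast_neg, Int.cast_zero, mul_one, mul_zero, mul_neg] at h
  · have := hk0 (u - u') (by linarith) (by linarith) (by linarith)
    simp [this.1, sub_eq_zero.1 this.2]
  · by_cases h0 : u + u' = 0
    · have e1 : u = 0 := by linarith
      have e2 : u' = 0 := by linarith
      have := hk0 0 (by linarith) (by linarith) (by linarith)
      simp [this.1, e1, e2]
    · have : 0 < u + u' := lt_of_le_of_ne (by linarith) (Ne.symm h0)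
      have := k1 (a' - a) (by push_cast; linarith) (by push_cast; linarith)
      simp; omega
  · have := hk0 u (by linarith) (by linarith) (by linarith)
    simp [this.1, this.2]
  · by_cases h0 : u + u' = 0
    · have e1 : u = 0 := by linarith
      have e2 : u' = 0 := by linarith
      have := hk0 0 (by linarith) (by linarith) (by linarith)
      simp [this.1, e1, e2]
    · have : 0 < u + u' := lt_of_le_of_ne (by linarith) (Ne.symm h0)
      have := k1 (a - a') (by push_cast; linarith) (by push_cast; linarith)
      simp; omega
  · have := hk0 (u' - u) (by linarith) (by linarith) (by linarith)
    simp [this.1, (sub_eq_zero.1 this.2)]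
  · have := hk0 (-u) (by linarith) (by linarith) (by linarith)
    simp [this.1, neg_eq_zero.1 this.2]
  · have := hk0 (-u') (by linarith) (by linarith) (by linarith)
    simp [this.1, neg_eq_zero.1 this.2]
  · have := hk0 (u') (by linarith) (by linarith) (by linarith)
    simp [this.1, this.2]
  · have := hk0 0 (by linarith) (by linarith) (by linarith)
    simp [this.1]

def UnitStep (v w : ℤ × ℤ) : Prop :=
  ((w.1 - v.1 = 1 ∨ w.1 - v.1 = -1) ∧ w.2 - v.2 = 0) ∨
  ((w.2 - v.2 = 1 ∨ w.2 - v.2 = -1) ∧ w.1 - v.1 = 0)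

theorem two_dim (h : ℝ) (hh : 0 < h) (v w v' w' : ℤ × ℤ) (s1 : UnitStep v w) (s2 : UnitStep v' w')
    (u u' : ℝ) (hu : 0 ≤ u) (hu1 : u < 1) (hu' : 0 ≤ u') (hu1' : u' < 1)
    (he : pos h v + (u : ℂ) * (pos h w - pos h v) = pos h v' + (u' : ℂ) * (pos h w' - pos h v')) :
    (v = v' ∧ u = u') ∨ (v' = w ∧ w' = v) := by
  obtain ⟨a, b⟩ := v
  obtain ⟨a2, b2⟩ := w
  obtain ⟨a', b'⟩ := v'
  obtain ⟨a2', b2'⟩ := w'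
  have e1 := congrArg Complex.re he
  have e2 := congrArg Complex.im he
  simp only [pos, Complex.add_re, Complex.mul_re, Complex.sub_re, Complex.ofReal_re,
    Complex.ofReal_im, zero_mul, sub_zero, Complex.add_im, Complex.mul_im, Complex.sub_im,
    add_zero] at e1 e2
  have e1 : (a : ℝ) + u * (a2 - a : ℤ) = a' + u' * (a2' - a' : ℤ) := by
    apply mul_left_cancel₀ hh.ne'
    push_cast
    linarith
  have e2 : (b : ℝ) + u * (b2 - b : ℤ) = b' + u' * (b2' - b' : ℤ) := by
    apply mul_left_cancel₀ hh.ne'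
    push_cast
    linarith
  simp only [UnitStep] at s1 s2
  have o1 := one_dim _ _ _ _ u u' hu hu1 hu' hu1' (by omega) (by omega) e1
  have o2 := one_dim _ _ _ _ u u' hu hu1 hu' hu1' (by omega) (by omega) e2
  simp only [Prod.mk.injEq]
  clear e1 e2 he
  by_cases hz : u = u'
  · subst hz
    rcases o1 with o1 | o1 | o1 | o1 | o1 | o1 <;> rcases o2 with o2 | o2 | o2 | o2 | o2 | o2 <;>
      first | (left; exact ⟨⟨by omega, by omega⟩, rfl⟩) | (right; omega) | (exfalso; omega)
  · have hz' : ¬ (u = 0 ∧ u' = 0) := by rintro ⟨rfl, rfl⟩; exact hz rfl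
    rcases o1 with o1 | o1 | o1 | o1 | o1 | o1 <;> rcases o2 with o2 | o2 | o2 | o2 | o2 | o2 <;>
      first | (right; omega) | (exfalso; omega) | (exfalso; exact hz' ⟨by tauto, by tauto⟩) | (exfalso; tauto)

theorem loop_of_cycle (h : ℝ) (hh : 0 < h) (G : SimpleGraph (ℤ × ℤ))
    (hG : ∀ a b, G.Adj a b → UnitStep a b) (o : ℤ × ℤ) (p : G.Walk o o) (hp : p.IsCycle) :
    ∃ γ : ℝ → ℂ, IsJordanLoop γ ∧ γ '' Set.Icc 0 1 = ⋃ i : Fin p.length,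
      segment ℝ (pos h (p.getVert i)) (pos h (p.getVert (i + 1))) := by
  set n := p.length with hn
  have hn3 : 3 ≤ n := hp.three_le_length
  have hn0 : (0 : ℝ) < n := by exact_mod_cast (by omega : 0 < n)
  set z : ℕ → ℂ := fun k => pos h (p.getVert k) with hz
  have hstep : ∀ m < n, UnitStep (p.getVert m) (p.getVert (m + 1)) := fun m hm =>
    hG _ _ (p.adj_getVert_succ hm)
  have hzn : p.getVert n = p.getVert 0 := by simp [hn]
  have hinj := hp.getVert_injOn'
  refine ⟨fun t => plf z n (n * t), ⟨?_, ?_, ?_⟩, ?_⟩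
  · exact ((plf_cont z n).comp (by fun_prop)).continuousOn
  · simp only
    rw [plf_eq z n 0 (by omega) _ (by simp) (by simp), plf_eq z n (n - 1) (by omega)]
    · simp only [hz]
      rw [show n - 1 + 1 = n by omega, hzn]
      push_cast [Nat.cast_sub (show 1 ≤ n by omega)]
      ring
    · push_cast [Nat.cast_sub (show 1 ≤ n by omega)]
      linarith
    · push_cast [Nat.cast_sub (show 1 ≤ n by omega)]
      linarith
  · intro t ht t' ht' he
    have key : ∀ t ∈ Set.Ico (0 : ℝ) 1, ∃ m < n, (m : ℝ) ≤ n * t ∧ n * t < m + 1 := by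
      intro t ht
      refine ⟨⌊(n : ℝ) * t⌋₊, ?_, Nat.floor_le (mul_nonneg hn0.le ht.1), Nat.lt_floor_add_one _⟩
      rw [Nat.floor_lt (mul_nonneg hn0.le ht.1)]
      nlinarith [ht.2]
    obtain ⟨m, hm, h1, h2⟩ := key t ht
    obtain ⟨m', hm', h1', h2'⟩ := key t' ht'
    simp only at he
    rw [plf_eq z n m hm _ h1 h2.le, plf_eq z n m' hm' _ h1' h2'.le] at he
    rcases two_dim h hh _ _ _ _ (hstep m hm) (hstep m' hm') _ _ (by linarith) (by linarith)
      (by linarith) (by linarith) he with ⟨e1, e2⟩ | ⟨e1, e2⟩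
    · have : m = m' := hinj (show m ≤ n - 1 by omega) (show m' ≤ n - 1 by omega) e1
      subst this
      have : (n : ℝ) * t = n * t' := by linarith
      exact mul_left_cancel₀ hn0.ne' this
    · exfalso
      have a1 : m' = m + 1 ∨ (m' = 0 ∧ m + 1 = n) := by
        by_cases hmn : m + 1 = n
        · rw [hmn, hzn] at e1
          exact Or.inr ⟨hinj (show m' ≤ n - 1 by omega) (show 0 ≤ n - 1 by omega) e1, hmn⟩
        · exact Or.inl (hinj (show m' ≤ n - 1 by omega) (show m + 1 ≤ n - 1 by omega) e1)
      have a2 : m = m' + 1 ∨ (m = 0 ∧ m' + 1 = n) := by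
        by_cases hmn : m' + 1 = n
        · rw [hmn, hzn] at e2
          exact Or.inr ⟨hinj (show m ≤ n - 1 by omega) (show 0 ≤ n - 1 by omega) e2.symm, hmn⟩
        · exact Or.inl (hinj (show m ≤ n - 1 by omega) (show m' + 1 ≤ n - 1 by omega) e2.symm)
      omega
  · ext w
    simp only [Set.mem_image, Set.mem_iUnion, segment_eq_image', Complex.real_smul]
    constructor
    · rintro ⟨t, ht, rfl⟩
      obtain ⟨m, hm, h1, h2⟩ : ∃ m < n, (m : ℝ) ≤ n * t ∧ n * t ≤ m + 1 := by
        by_cases h1 : t = 1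
        · refine ⟨n - 1, by omega, ?_, ?_⟩ <;> push_cast [Nat.cast_sub (show 1 ≤ n by omega)] <;>
            rw [h1] <;> linarith
        · refine ⟨⌊(n : ℝ) * t⌋₊, ?_, Nat.floor_le (mul_nonneg hn0.le ht.1),
            (Nat.lt_floor_add_one _).le⟩
          rw [Nat.floor_lt (mul_nonneg hn0.le ht.1)]
          have := lt_of_le_of_ne ht.2 h1
          nlinarith
      refine ⟨⟨m, hm⟩, n * t - m, ⟨by linarith, by linarith⟩, ?_⟩
      rw [plf_eq z n m hm _ h1 h2]
    · rintro ⟨⟨m, hm⟩, u, hu, rfl⟩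
      have hm1 : (m : ℝ) + 1 ≤ n := by exact_mod_cast hm
      have e : (n : ℝ) * ((m + u) / n) = m + u := by field_simp
      refine ⟨(m + u) / n, ⟨div_nonneg (add_nonneg (Nat.cast_nonneg m) hu.1) hn0.le, ?_⟩, ?_⟩
      · rw [div_le_one hn0]; linarith [hu.2]
      · rw [e, plf_eq z n m hm _ (by linarith [hu.1]) (by linarith [hu.2])]
        simp [hz]

theorem connQ {U A : Set ℂ} (hU : IsOpen U) (hc : IsConnected U) (hA : IsCompact A) (hAU : A ⊆ U) :
    ∃ Q, A ⊆ Q ∧ Q ⊆ U ∧ IsCompact Q ∧ IsConnected Q := by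
  obtain ⟨u0, hu0⟩ := hc.nonempty
  have hpc := hU.isConnected_iff_isPathConnected.1 hc
  have : ∃ Q, A ⊆ Q ∧ Q ⊆ U ∧ IsCompact Q ∧ IsPreconnected Q ∧ u0 ∈ Q := by
    refine hA.induction_on (p := fun A => ∃ Q, A ⊆ Q ∧ Q ⊆ U ∧ IsCompact Q ∧ IsPreconnected Q ∧ u0 ∈ Q)
      ?_ ?_ ?_ ?_
    · exact ⟨{u0}, by simp, by simpa using hu0, isCompact_singleton, isPreconnected_singleton, by simp⟩
    · rintro s t hst ⟨Q, h1, h2⟩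
      exact ⟨Q, hst.trans h1, h2⟩
    · rintro s t ⟨Q, a1, a2, a3, a4, a5⟩ ⟨R, b1, b2, b3, b4, b5⟩
      exact ⟨Q ∪ R, Set.union_subset_union a1 b1, Set.union_subset a2 b2, a3.union b3,
        a4.union u0 a5 b5 b4, Or.inl a5⟩
    · intro x hx
      obtain ⟨r, hr, hb⟩ := Metric.nhds_basis_closedBall.mem_iff.1 (hU.mem_nhds (hAU hx))
      obtain ⟨γ, hγ⟩ := hpc.joinedIn u0 hu0 x (hAU hx)
      refine ⟨Metric.closedBall x r, mem_nhdsWithin_of_mem_nhds (Metric.closedBall_mem_nhds x hr),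
        Metric.closedBall x r ∪ Set.range γ, Set.subset_union_left, ?_, ?_, ?_, ?_⟩
      · refine Set.union_subset hb ?_
        rintro _ ⟨t, rfl⟩; exact hγ t
      · exact (isCompact_closedBall x r).union (isCompact_range γ.continuous)
      · exact (convex_closedBall x r).isPreconnected.union x (Metric.mem_closedBall_self hr.le)
          ⟨1, by simp⟩ (isPreconnected_range γ.continuous)
      · exact Or.inr ⟨0, by simp⟩
  obtain ⟨Q, a1, a2, a3, a4, a5⟩ := this
  exact ⟨Q, a1, a2, a3, ⟨u0, a5⟩, a4⟩

noncomputable def sC (h : ℝ) (z : ℂ) : ℝ := (z.re / h + z.im / h - 1) / 2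
noncomputable def tC (h : ℝ) (z : ℂ) : ℝ := (z.re / h - z.im / h + 1) / 2

def FrQ (h : ℝ) (Q : Set ℂ) : Set (ℤ × ℤ) :=
  {p | ∃ z ∈ Q, ∃ i j : ℤ, |(i : ℝ) - sC h z| < 1 ∧ |(j : ℝ) - tC h z| < 1 ∧ p = (i + j, i - j + 1)}

theorem FrQ_odd (h : ℝ) (Q : Set ℂ) (p : ℤ × ℤ) (hp : p ∈ FrQ h Q) : (p.1 + p.2) % 2 = 1 := by
  obtain ⟨z, hz, i, j, h1, h2, rfl⟩ := hp
  simp only; omega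

theorem FrQ_near (h : ℝ) (hh : 0 < h) (Q : Set ℂ) (p : ℤ × ℤ) (hp : p ∈ FrQ h Q) :
    ∃ z ∈ Q, |h * p.1 - z.re| ≤ 2 * h ∧ |h * p.2 - z.im| ≤ 2 * h := by
  obtain ⟨z, hz, i, j, h1, h2, rfl⟩ := hp
  refine ⟨z, hz, ?_⟩
  have e1 : z.re = h * (z.re / h) := by field_simp
  have e2 : z.im = h * (z.im / h) := by field_simp
  rw [abs_lt] at h1 h2
  simp only [sC, tC] at h1 h2
  have key : ∀ a b : ℝ, -2 ≤ a - b → a - b ≤ 2 → |h * a - h * b| ≤ 2 * h := by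
    intro a b g1 g2
    rw [← mul_sub, abs_mul, abs_of_pos hh, mul_comm]
    exact mul_le_mul_of_nonneg_right (abs_le.2 ⟨g1, g2⟩) hh.le
  constructor
  · rw [e1]
    apply key <;> push_cast <;> linarith
  · rw [e2]
    apply key <;> push_cast <;> linarith

theorem FrQ_mem (h : ℝ) (hh : 0 < h) (Q : Set ℂ) (p : ℤ × ℤ) (ho : (p.1 + p.2) % 2 = 1)
    (hp : pos h p ∈ Q) : p ∈ FrQ h Q := by
  obtain ⟨x, y⟩ := p
  simp only at ho
  obtain ⟨i, hi⟩ : ∃ i, x + y - 1 = 2 * i := ⟨(x + y - 1) / 2, by omega⟩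
  obtain ⟨j, hj⟩ : ∃ j, x - y + 1 = 2 * j := ⟨(x - y + 1) / 2, by omega⟩
  have hi' : (x : ℝ) + y - 1 = 2 * i := by exact_mod_cast hi
  have hj' : (x : ℝ) - y + 1 = 2 * j := by exact_mod_cast hj
  refine ⟨_, hp, i, j, ?_, ?_, ?_⟩
  · simp only [sC, pos, mul_div_cancel_left₀ _ hh.ne', hi']
    norm_num
  · simp only [tC, pos, mul_div_cancel_left₀ _ hh.ne', hj']
    norm_num
  · ext <;> simp only <;> omega

theorem FrQ_conn (h : ℝ) (Q : Set ℂ) (hQ : IsPreconnected Q) (p0 : ℤ × ℤ) (hp0 : p0 ∈ FrQ h Q)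
    (P : ℤ × ℤ → Prop) (h0 : P p0)
    (hd : ∀ p ∈ FrQ h Q, ∀ q ∈ FrQ h Q, Diag p q → P p → P q) : ∀ p ∈ FrQ h Q, P p := by
  set A : ℂ → Prop := fun z => ∀ i j : ℤ, |(i : ℝ) - sC h z| < 1 → |(j : ℝ) - tC h z| < 1 →
    P (i + j, i - j + 1) with hA
  have all : ∀ z ∈ Q, ∀ i j : ℤ, |(i : ℝ) - sC h z| < 1 → |(j : ℝ) - tC h z| < 1 →
      P (i + j, i - j + 1) → A z := by
    intro z hz i j hi hj hP i' j' hi' hj'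
    have m1 : (i + j, i - j + 1) ∈ FrQ h Q := ⟨z, hz, i, j, hi, hj, rfl⟩
    have m2 : (i' + j, i' - j + 1) ∈ FrQ h Q := ⟨z, hz, i', j, hi', hj, rfl⟩
    have m3 : (i' + j', i' - j' + 1) ∈ FrQ h Q := ⟨z, hz, i', j', hi', hj', rfl⟩
    have cl : ∀ (a b : ℤ) (s : ℝ), |(a : ℝ) - s| < 1 → |(b : ℝ) - s| < 1 →
        a = b ∨ b = a + 1 ∨ b = a - 1 := by
      intro a b s h1 h2
      rw [abs_lt] at h1 h2
      have g1 : ((b - a : ℤ) : ℝ) < (2 : ℤ) := by push_cast; linarith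
      have g2 : ((-2 : ℤ) : ℝ) < (b - a : ℤ) := by push_cast; linarith
      rw [Int.cast_lt] at g1 g2
      omega
    have hP2 : P (i' + j, i' - j + 1) := by
      rcases cl _ _ _ hi hi' with rfl | e
      · exact hP
      · refine hd _ m1 _ m2 ?_ hP
        simp only [Diag]; omega
    rcases cl _ _ _ hj hj' with rfl | e
    · exact hP2
    · refine hd _ m2 _ m3 ?_ hP2
      simp only [Diag]; omega
  have rel : ∀ x ∈ Q, ∀ y ∈ Q, (A x ↔ A y) := by
    intro x hx y hy
    refine hQ.induction₂ (fun x y => (A x ↔ A y)) ?_ ?_ ?_ hx hy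
    · intro x hx
      have c1 : Continuous (sC h) := by unfold sC; fun_prop
      have c2 : Continuous (tC h) := by unfold tC; fun_prop
      have e1 := (c1.tendsto x).eventually (Metric.ball_mem_nhds _ (show (0 : ℝ) < 1 / 2 by norm_num))
      have e2 := (c2.tendsto x).eventually (Metric.ball_mem_nhds _ (show (0 : ℝ) < 1 / 2 by norm_num))
      filter_upwards [mem_nhdsWithin_of_mem_nhds e1, mem_nhdsWithin_of_mem_nhds e2,
        self_mem_nhdsWithin] with y g1 g2 hy
      replace g1 : |sC h y - sC h x| < 1 / 2 := g1
      replace g2 : |tC h y - tC h x| < 1 / 2 := g2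
      have r1 := abs_sub_round (sC h x)
      have r2 := abs_sub_round (tC h x)
      have a1 : |(round (sC h x) : ℝ) - sC h x| < 1 := by rw [abs_sub_comm]; linarith
      have a2 : |(round (tC h x) : ℝ) - tC h x| < 1 := by rw [abs_sub_comm]; linarith
      have a3 : |(round (sC h x) : ℝ) - sC h y| < 1 := by
        rw [abs_lt] at g1 ⊢; rw [abs_le] at r1; constructor <;> linarith
      have a4 : |(round (tC h x) : ℝ) - tC h y| < 1 := by
        rw [abs_lt] at g2 ⊢; rw [abs_le] at r2; constructor <;> linarith
      exact ⟨fun H => all y hy _ _ a3 a4 (H _ _ a1 a2), fun H => all x hx _ _ a1 a2 (H _ _ a3 a4)⟩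
    · intro x y z _ _ _ h1 h2; exact h1.trans h2
    · intro x y _ _ h1; exact h1.symm
  obtain ⟨z, hz, i, j, hi, hj, rfl⟩ := hp0
  have hz0 := all z hz i j hi hj h0
  rintro p ⟨z', hz', i', j', hi', hj', rfl⟩
  exact (rel z hz z' hz').1 hz0 i' j' hi' hj'

def cell (h : ℝ) (p : ℤ × ℤ) : Set ℂ := Set.Icc (h * p.1) (h * (p.1 + 1)) ×ℂ Set.Icc (h * p.2) (h * (p.2 + 1))

theorem mem_cell (h : ℝ) (p : ℤ × ℤ) (z : ℂ) : z ∈ cell h p ↔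
    (h * p.1 ≤ z.re ∧ z.re ≤ h * (p.1 + 1)) ∧ (h * p.2 ≤ z.im ∧ z.im ≤ h * (p.2 + 1)) := by
  simp [cell, Complex.mem_reProdIm]

theorem cell_compact (h : ℝ) (p : ℤ × ℤ) : IsCompact (cell h p) := isCompact_Icc.reProdIm isCompact_Icc

theorem exists_cell (h : ℝ) (hh : 0 < h) (z : ℂ) : ∃ p, z ∈ cell h p := by
  refine ⟨(⌊z.re / h⌋, ⌊z.im / h⌋), ?_⟩
  rw [mem_cell]
  have key : ∀ a : ℝ, h * (⌊a / h⌋ : ℝ) ≤ a ∧ a ≤ h * ((⌊a / h⌋ : ℝ) + 1) := by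
    intro a
    have e : a = h * (a / h) := by field_simp
    constructor
    · conv_rhs => rw [e]
      exact mul_le_mul_of_nonneg_left (Int.floor_le _) hh.le
    · conv_lhs => rw [e]
      exact mul_le_mul_of_nonneg_left (Int.lt_floor_add_one _).le hh.le
  exact ⟨key _, key _⟩

theorem int_le_of_mul (h : ℝ) (hh : 0 < h) (a b : ℤ) (H : h * a ≤ h * b) : a ≤ b := by
  have := le_of_mul_le_mul_left H hh
  exact_mod_cast this

theorem cells_closed (h : ℝ) (hh : 0 < h) (S : Set (ℤ × ℤ)) : IsClosed (⋃ p ∈ S, cell h p) := by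
  have hlf : LocallyFinite (fun p : ℤ × ℤ => cell h p) := by
    intro z
    obtain ⟨q, hq⟩ := exists_cell h hh z
    refine ⟨Metric.ball z h, Metric.ball_mem_nhds z hh, ?_⟩
    refine ((Set.finite_Icc (q.1 - 3) (q.1 + 3)).prod (Set.finite_Icc (q.2 - 3) (q.2 + 3))).subset ?_
    rintro p ⟨w, hw, hwz⟩
    rw [mem_cell] at hw hq
    rw [Metric.mem_ball, Complex.dist_eq] at hwz
    have g1 := abs_lt.1 ((Complex.abs_re_le_norm (w - z)).trans_lt hwz)
    have g2 := abs_lt.1 ((Complex.abs_im_le_norm (w - z)).trans_lt hwz)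
    simp only [Complex.sub_re, Complex.sub_im] at g1 g2
    simp only [Set.mem_prod, Set.mem_Icc]
    refine ⟨⟨?_, ?_⟩, ?_, ?_⟩ <;> apply int_le_of_mul h hh <;> push_cast <;> linarith
  have := hlf.comp_injective (g := (Subtype.val : S → ℤ × ℤ)) Subtype.val_injective
  rw [Set.biUnion_eq_iUnion]
  exact this.isClosed_iUnion fun p => (cell_compact h p).isClosed

theorem seg_v (h : ℝ) (hh : 0 < h) (x y : ℤ) (z : ℂ) (h1 : z.re = h * x) (h2 : h * y ≤ z.im)
    (h3 : z.im ≤ h * (y + 1)) : z ∈ segment ℝ (pos h (x, y)) (pos h (x, y + 1)) := by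
  rw [segment_eq_image']
  refine ⟨z.im / h - y, ⟨?_, ?_⟩, ?_⟩
  · rw [sub_nonneg, le_div_iff₀ hh]; linarith
  · rw [sub_le_iff_le_add, div_le_iff₀ hh]; linarith
  · apply Complex.ext
    · simp [pos, h1]
    · simp [pos]; field_simp; ring

theorem seg_h (h : ℝ) (hh : 0 < h) (x y : ℤ) (z : ℂ) (h1 : z.im = h * y) (h2 : h * x ≤ z.re)
    (h3 : z.re ≤ h * (x + 1)) : z ∈ segment ℝ (pos h (x, y)) (pos h (x + 1, y)) := by
  rw [segment_eq_image']
  refine ⟨z.re / h - x, ⟨?_, ?_⟩, ?_⟩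
  · rw [sub_nonneg, le_div_iff₀ hh]; linarith
  · rw [sub_le_iff_le_add, div_le_iff₀ hh]; linarith
  · apply Complex.ext
    · simp [pos]; field_simp; ring
    · simp [pos, h1]

theorem edge_of_two (h : ℝ) (hh : 0 < h) (c : ℤ → ℤ → Bool) (z : ℂ) (p q : ℤ × ℤ)
    (hp : z ∈ cell h p) (hq : z ∈ cell h q) (hne : c p.1 p.2 ≠ c q.1 q.2) :
    ∃ a b, (bG c).Adj a b ∧ z ∈ segment ℝ (pos h a) (pos h b) := by
  have H : ∀ x x' y : ℤ, z ∈ cell h (x, y) → z ∈ cell h (x', y) → c x y ≠ c x' y → x ≤ x' →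
      ∃ a b, (bG c).Adj a b ∧ z ∈ segment ℝ (pos h a) (pos h b) := by
    intro x x' y h1 h2 hn hle
    rw [mem_cell] at h1 h2
    simp only at h1 h2
    have hx : x' ≤ x + 1 := by apply int_le_of_mul h hh; push_cast; linarith
    have hx' : x' = x + 1 := by
      rcases eq_or_lt_of_le hle with rfl | h
      · exact absurd rfl hn
      · omega
    subst hx'
    push_cast at h2
    refine ⟨(x + 1, y), (x + 1, y + 1), ?_, seg_v h hh _ _ z ?_ h1.2.1 h1.2.2⟩
    · rw [bG_v]; simpa using hn.symm
    · push_cast; linarith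
  have V : ∀ x y y' : ℤ, z ∈ cell h (x, y) → z ∈ cell h (x, y') → c x y ≠ c x y' → y ≤ y' →
      ∃ a b, (bG c).Adj a b ∧ z ∈ segment ℝ (pos h a) (pos h b) := by
    intro x y y' h1 h2 hn hle
    rw [mem_cell] at h1 h2
    simp only at h1 h2
    have hx : y' ≤ y + 1 := by apply int_le_of_mul h hh; push_cast; linarith
    have hx' : y' = y + 1 := by
      rcases eq_or_lt_of_le hle with rfl | h
      · exact absurd rfl hn
      · omega
    subst hx'
    push_cast at h2
    refine ⟨(x, y + 1), (x + 1, y + 1), ?_, seg_h h hh _ _ z ?_ h1.1.1 h1.1.2⟩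
    · rw [bG_h]; simpa using hn.symm
    · push_cast; linarith
  obtain ⟨x, y⟩ := p
  obtain ⟨x', y'⟩ := q
  simp only at hne
  have hm : z ∈ cell h (x, y') := by
    rw [mem_cell] at hp hq ⊢
    exact ⟨hp.1, hq.2⟩
  by_cases h1 : c x y = c x y'
  · rw [h1] at hne
    rcases le_total x x' with h | h
    · exact H _ _ _ hm hq hne h
    · exact H _ _ _ hq hm hne.symm h
  · rcases le_total y y' with h | h
    · exact V _ _ _ hp hm h1 h
    · exact V _ _ _ hm hp (Ne.symm h1) h

theorem adj_free {Fr Eo : Set (ℤ × ℤ)} (hs : SepC Fr Eo) (T : ℤ × ℤ → Bool) (u v : ℤ × ℤ)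
    (h : (bG (col Fr Eo T)).Adj u v) : ∃ p ∈ Fr, (-2 ≤ u.1 - p.1 ∧ u.1 - p.1 ≤ 2) ∧
      (-2 ≤ u.2 - p.2 ∧ u.2 - p.2 ≤ 2) ∧ (-2 ≤ v.1 - p.1 ∧ v.1 - p.1 ≤ 2) ∧
      (-2 ≤ v.2 - p.2 ∧ v.2 - p.2 ≤ 2) := by
  have key : ∀ x y a b, (a, b) ∈ nbs x y → col Fr Eo T x y ≠ col Fr Eo T a b →
      ∃ p ∈ Fr, p ∈ nbs x y ∨ p ∈ nbs a b := by
    intro x y a b hab hne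
    by_cases hev : (x + y) % 2 = 0
    · have hf : hasF Fr x y := by
        by_contra hf
        exact hne (col_nofree hs T hev hf hab).symm
      obtain ⟨p, h1, h2⟩ := (hasF_iff _ _ _).1 hf
      exact ⟨p, h2, Or.inl h1⟩
    · have hf : hasF Fr a b := by
        by_contra hf
        refine hne (col_nofree hs T (x := a) (y := b) ?_ hf ?_)
        · simp only [mem_nbs, Prod.mk.injEq] at hab; omega
        · simp only [mem_nbs, Prod.mk.injEq] at hab ⊢; omega
      obtain ⟨p, h1, h2⟩ := (hasF_iff _ _ _).1 hf
      exact ⟨p, h2, Or.inr h1⟩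
  obtain ⟨i, j⟩ := u
  obtain ⟨i', j'⟩ := v
  rw [bG_adj] at h
  simp only at h
  rcases h with ⟨e1, e2, h⟩ | ⟨e1, e2, h⟩ | ⟨e1, e2, h⟩ | ⟨e1, e2, h⟩ <;>
  · obtain ⟨⟨a, b⟩, hp, h1⟩ := key _ _ _ _ (by simp [nbs]) h
    refine ⟨_, hp, ?_⟩
    simp only [mem_nbs, Prod.mk.injEq] at h1 ⊢
    omega

theorem dist_le_of_coord (z w : ℂ) (a b : ℝ) (h1 : |z.re - w.re| ≤ a) (h2 : |z.im - w.im| ≤ b) :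
    dist z w ≤ a + b := by
  rw [Complex.dist_eq]
  have := Complex.norm_le_abs_re_add_abs_im (z - w)
  simp only [Complex.sub_re, Complex.sub_im] at this
  linarith

theorem cell_dist (h : ℝ) (z : ℂ) (p : ℤ × ℤ) (hz : z ∈ cell h p) : dist z (pos h p) ≤ h + h := by
  rw [mem_cell] at hz
  apply dist_le_of_coord <;> rw [abs_le] <;> simp only [pos] <;> constructor <;> linarith

theorem cell_dist' (h : ℝ) (z : ℂ) (x y : ℤ) (hz : z ∈ cell h (x, y)) :
    dist z (pos h (x + 1, y)) ≤ h + h := by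
  rw [mem_cell] at hz
  simp only at hz
  apply dist_le_of_coord <;> rw [abs_le] <;> simp only [pos] <;> push_cast <;> constructor <;> linarith

theorem bnd_int (h : ℝ) (hh : 0 < h) (a N : ℤ) (M : ℝ) (h1 : |h * a| ≤ M) (h2 : M ≤ h * N) :
    -N ≤ a ∧ a ≤ N := by
  rw [abs_le] at h1
  constructor <;> apply int_le_of_mul h hh <;> push_cast <;> linarith

theorem mul_int_bd (h : ℝ) (hh : 0 < h) (a b : ℤ) (k : ℤ) (h1 : -k ≤ a - b) (h2 : a - b ≤ k) :
    |h * a - h * b| ≤ k * h := by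
  rw [← mul_sub, abs_mul, abs_of_pos hh, mul_comm]
  refine mul_le_mul_of_nonneg_right (abs_le.2 ⟨?_, ?_⟩) hh.le <;> exact_mod_cast ‹_›

theorem plane (E0 F0 : Set ℂ) (hE : IsCompact E0) (hne : E0.Nonempty) (hF : IsClosed F0)
    (hd : Disjoint E0 F0) (hU : IsConnected (E0 ∪ F0)ᶜ) :
    ∃ γ : ℝ → ℂ, IsJordanLoop γ ∧ γ '' Icc 0 1 ⊆ (E0 ∪ F0)ᶜ ∧ FinUnionHV (γ '' Icc 0 1) ∧
      ∃ KB KW : Set ℂ, IsCompact KB ∧ IsClosed KW ∧ KB ∪ KW = univ ∧ KB ∩ KW ⊆ γ '' Icc 0 1 ∧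
        E0 ⊆ KB ∧ F0 ⊆ KW := by
  have hUo : IsOpen (E0 ∪ F0)ᶜ := (hE.isClosed.union hF).isOpen_compl
  obtain ⟨r, hr, hF3⟩ : ∃ r > 0, ∀ z ∈ F0, 3 * r < Metric.infDist z E0 := by
    obtain ⟨ρ, hρ, hs⟩ := hE.exists_cthickening_subset_open hF.isOpen_compl
      (disjoint_left.1 hd)
    refine ⟨ρ / 3, by positivity, fun z hz => ?_⟩
    by_contra hlt
    obtain ⟨e, he, hed⟩ := hE.exists_infDist_eq_dist hne z
    refine hs (Metric.closedBall_subset_cthickening he ρ ?_) hz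
    rw [Metric.mem_closedBall]; linarith
  have lip : ∀ z w : ℂ, Metric.infDist z E0 ≤ Metric.infDist w E0 + dist z w :=
    fun z w => Metric.infDist_le_infDist_add_dist
  have hE0 : ∀ z ∈ E0, Metric.infDist z E0 = 0 := fun z hz => Metric.infDist_zero_of_mem hz
  have cinf : Continuous fun z : ℂ => Metric.infDist z E0 := Metric.continuous_infDist_pt E0
  set A : Set ℂ := {z | r ≤ Metric.infDist z E0 ∧ Metric.infDist z E0 ≤ 2 * r} with hAdef
  have hAc : IsCompact A := by
    refine (hE.cthickening (r := 2 * r)).of_isClosed_subset ?_ ?_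
    · exact (isClosed_le continuous_const cinf).inter (isClosed_le cinf continuous_const)
    · rintro z ⟨_, hz⟩
      obtain ⟨e, he, hed⟩ := hE.exists_infDist_eq_dist hne z
      refine Metric.closedBall_subset_cthickening he _ ?_
      rw [Metric.mem_closedBall]; linarith
  have hAU : A ⊆ (E0 ∪ F0)ᶜ := by
    rintro z ⟨h1, h2⟩ (hz | hz)
    · have := hE0 z hz; linarith
    · have := hF3 z hz; linarith
  obtain ⟨Q, hAQ, hQU, hQc, hQconn⟩ := connQ hUo hU hAc hAU
  obtain ⟨δ, hδ, hQδ⟩ := hQc.exists_cthickening_subset_open hUo hQU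
  have near : ∀ z ∈ Q, ∀ w, dist w z ≤ δ → w ∈ (E0 ∪ F0)ᶜ := fun z hz w hw =>
    hQδ (Metric.closedBall_subset_cthickening hz δ (Metric.mem_closedBall.2 hw))
  obtain ⟨h, hh, hhδ, hhr⟩ : ∃ h > 0, 10 * h ≤ δ ∧ 10 * h ≤ r := by
    refine ⟨min δ r / 10, by positivity, ?_, ?_⟩
    · have := min_le_left δ r; linarith
    · have := min_le_right δ r; linarith
  set Fr := FrQ h Q with hFr
  set Eo : Set (ℤ × ℤ) := {p | Metric.infDist (pos h p) E0 < 3 / 2 * r} with hEo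
  have hodd : ∀ p ∈ Fr, (p.1 + p.2) % 2 = 1 := fun p hp => FrQ_odd h Q p hp
  have hs : SepC Fr Eo := by
    have key : ∀ x y, (x + y) % 2 = 0 → ∀ a ∈ nbs x y, ∀ b ∈ nbs x y, a ∉ Fr → b ∉ Fr →
        a ∈ Eo → b ∈ Eo := by
      rintro x y hxy ⟨a1, a2⟩ ha ⟨b1, b2⟩ hb hfa hfb hea
      by_contra heb
      have h1 : Metric.infDist (pos h (a1, a2)) E0 < 3 / 2 * r := hea
      have h2 : 3 / 2 * r ≤ Metric.infDist (pos h (b1, b2)) E0 := not_lt.1 heb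
      have hD : dist (pos h (b1, b2)) (pos h (a1, a2)) ≤ (2 : ℤ) * h + (2 : ℤ) * h := by
        simp only [mem_nbs, Prod.mk.injEq] at ha hb
        apply dist_le_of_coord <;> apply mul_int_bd h hh <;> omega
      push_cast at hD
      have := lip (pos h (b1, b2)) (pos h (a1, a2))
      exact hfa (FrQ_mem h hh Q _ (nbs_odd hxy ha) (hAQ ⟨by linarith, by linarith⟩))
    intro x y hxy a ha b hb hfa hfb
    exact ⟨key x y hxy a ha b hb hfa hfb, key x y hxy b hb a ha hfb hfa⟩
  obtain ⟨N, hFN, hEN⟩ : ∃ N : ℤ, (∀ p ∈ Fr, -N ≤ p.1 ∧ p.1 ≤ N ∧ -N ≤ p.2 ∧ p.2 ≤ N) ∧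
      (∀ p ∈ Eo, -N ≤ p.1 ∧ p.1 ≤ N ∧ -N ≤ p.2 ∧ p.2 ≤ N) := by
    obtain ⟨R, hR⟩ := (hQc.union hE).isBounded.exists_norm_le
    have hN : (R + 2 * r + 2 * h) ≤ h * (⌈(R + 2 * r + 2 * h) / h⌉ : ℝ) := by
      have := Int.le_ceil ((R + 2 * r + 2 * h) / h)
      rw [div_le_iff₀ hh] at this
      linarith
    have go : ∀ (z : ℂ) (p : ℤ × ℤ), z ∈ Q ∪ E0 → |h * p.1 - z.re| ≤ 2 * r + 2 * h →
        |h * p.2 - z.im| ≤ 2 * r + 2 * h → |h * p.1| ≤ R + 2 * r + 2 * h ∧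
        |h * p.2| ≤ R + 2 * r + 2 * h := by
      intro z p hz h1 h2
      have g1 := abs_le.1 ((Complex.abs_re_le_norm z).trans (hR z hz))
      have g2 := abs_le.1 ((Complex.abs_im_le_norm z).trans (hR z hz))
      rw [abs_le] at h1 h2 ⊢
      rw [abs_le]
      refine ⟨⟨?_, ?_⟩, ?_, ?_⟩ <;> linarith
    refine ⟨⌈(R + 2 * r + 2 * h) / h⌉, fun p hp => ?_, fun p hp => ?_⟩
    · obtain ⟨z, hz, h1, h2⟩ := FrQ_near h hh Q p hp
      obtain ⟨g1, g2⟩ := go z p (Or.inl hz) (by linarith) (by linarith)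
      have a1 := bnd_int h hh _ _ _ g1 hN
      have a2 := bnd_int h hh _ _ _ g2 hN
      exact ⟨a1.1, a1.2, a2.1, a2.2⟩
    · obtain ⟨z, hz, hlt⟩ := (Metric.infDist_lt_iff hne).1 (show Metric.infDist (pos h p) E0 < 3 / 2 * r from hp)
      rw [Complex.dist_eq] at hlt
      have q1 := (Complex.abs_re_le_norm (pos h p - z))
      have q2 := (Complex.abs_im_le_norm (pos h p - z))
      simp only [Complex.sub_re, Complex.sub_im, pos] at q1 q2 hlt
      obtain ⟨g1, g2⟩ := go z p (Or.inr hz) (by linarith) (by linarith)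
      have a1 := bnd_int h hh _ _ _ g1 hN
      have a2 := bnd_int h hh _ _ _ g2 hN
      exact ⟨a1.1, a1.2, a2.1, a2.2⟩
  obtain ⟨p0, hp0⟩ : ∃ p0, p0 ∈ Fr := by
    obtain ⟨z, hz⟩ := hQconn.nonempty
    refine ⟨_, z, hz, round (sC h z), round (tC h z), ?_, ?_, rfl⟩
    · rw [abs_sub_comm]; linarith [abs_sub_round (sC h z)]
    · rw [abs_sub_comm]; linarith [abs_sub_round (tC h z)]
  obtain ⟨T, ⟨w, hw⟩, hreach⟩ := discrete Fr Eo hs N hodd hFN hEN p0 hp0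
    (fun P h0 hd => FrQ_conn h Q hQconn.isPreconnected p0 hp0 P h0 hd)
  set c := col Fr Eo T with hcdef
  have hbd := col_bdd N hFN hEN T
  have hfin : (bG c).support.Finite := by
    refine Set.Finite.subset ?_ (bG_supp c (N + 1) hbd)
    exact (Set.finite_Icc _ _).prod (Set.finite_Icc _ _)
  obtain ⟨o, p, hp, hpall⟩ := cyc_exists hfin (bG_cycles c (col_nochk hs T)) hw
  have hstep : ∀ a b, (bG c).Adj a b → UnitStep a b := by
    intro a b hab
    rw [bG_adj] at hab
    unfold UnitStep
    omega
  obtain ⟨γ, hγ, himg⟩ := loop_of_cycle h hh (bG c) hstep o p hp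
  have hadj : ∀ i : Fin p.length, (bG c).Adj (p.getVert i) (p.getVert (i + 1)) := fun i =>
    p.adj_getVert_succ i.2
  have hFrfar : ∀ z ∈ E0 ∪ F0, ∀ q ∈ Fr, ∀ k : ℝ, k ≤ 6 → ¬ dist z (pos h q) ≤ k * h := by
    intro z hz q hq k hk hle
    obtain ⟨z', hz', h1, h2⟩ := FrQ_near h hh Q q hq
    have := dist_le_of_coord (pos h q) z' _ _ h1 h2
    have t := dist_triangle z (pos h q) z'
    refine near z' hz' z ?_ hz
    nlinarith
  have hcol : ∀ z ∈ E0 ∪ F0, ∀ q : ℤ × ℤ, z ∈ cell h q →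
      ∃ q' : ℤ × ℤ, dist z (pos h q') ≤ 2 * h ∧ c q.1 q.2 = decide (q' ∈ Eo) := by
    rintro z hz ⟨x, y⟩ hq
    simp only
    by_cases ho : (x + y) % 2 = 1
    · have hd1 := cell_dist h z _ hq
      have : (x, y) ∉ Fr := fun hf => hFrfar z hz _ hf 2 (by norm_num) (by linarith)
      refine ⟨(x, y), by linarith, ?_⟩
      simp only [hcdef, col, ho, this, if_true, if_false]
    · have hd1 := cell_dist h z _ hq
      have hd2 := cell_dist' h z _ _ hq
      have : ¬ hasF Fr x y := by
        rw [hasF_iff]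
        rintro ⟨⟨a, b⟩, ha, hf⟩
        refine hFrfar z hz _ hf 4 (by norm_num) ?_
        have hD : dist (pos h (x, y)) (pos h (a, b)) ≤ (1 : ℤ) * h + (1 : ℤ) * h := by
          simp only [mem_nbs, Prod.mk.injEq] at ha
          apply dist_le_of_coord <;> apply mul_int_bd h hh <;> omega
        push_cast at hD
        have t := dist_triangle z (pos h (x, y)) (pos h (a, b))
        linarith
      refine ⟨(x + 1, y), by linarith, ?_⟩
      simp only [hcdef, col, ho, this, if_false]
  refine ⟨γ, hγ, ?_, ?_, ⋃ q ∈ {q : ℤ × ℤ | c q.1 q.2 = true}, cell h q,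
    ⋃ q ∈ {q : ℤ × ℤ | c q.1 q.2 = false}, cell h q, ?_, cells_closed h hh _, ?_, ?_, ?_, ?_⟩
  · rw [himg]
    refine iUnion_subset fun i => ?_
    obtain ⟨q, hq, h1, h2, h3, h4⟩ := adj_free hs T _ _ (hadj i)
    obtain ⟨z, hz, g1, g2⟩ := FrQ_near h hh Q q hq
    have bq := dist_le_of_coord (pos h q) z _ _ g1 g2
    have b1 : dist (pos h (p.getVert i)) (pos h q) ≤ (2 : ℤ) * h + (2 : ℤ) * h := by
      apply dist_le_of_coord <;> apply mul_int_bd h hh <;> omega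
    have b2 : dist (pos h (p.getVert (i + 1))) (pos h q) ≤ (2 : ℤ) * h + (2 : ℤ) * h := by
      apply dist_le_of_coord <;> apply mul_int_bd h hh <;> omega
    push_cast at b1 b2
    have t1 := dist_triangle (pos h (p.getVert i)) (pos h q) z
    have t2 := dist_triangle (pos h (p.getVert (i + 1))) (pos h q) z
    intro w hw
    refine near z hz w ?_
    exact (convex_closedBall z δ).segment_subset (Metric.mem_closedBall.2 (by linarith))
      (Metric.mem_closedBall.2 (by linarith)) hw
  · refine ⟨p.length, _, _, fun i => ?_, himg⟩
    have := hstep _ _ (hadj i)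
    rcases this with ⟨_, g⟩ | ⟨_, g⟩
    · right
      have e : (p.getVert (i + 1)).2 = (p.getVert i).2 := by omega
      simp only [pos, e]
    · left
      have e : (p.getVert (i + 1)).1 = (p.getVert i).1 := by omega
      simp only [pos, e]
  · refine Set.Finite.isCompact_biUnion ?_ fun q _ => cell_compact h q
    refine ((Set.finite_Icc (-(N + 1)) (N + 1)).prod (Set.finite_Icc (-(N + 1)) (N + 1))).subset ?_
    intro q hq
    have := hbd _ _ hq
    exact ⟨⟨this.1, this.2.1⟩, this.2.2.1, this.2.2.2⟩
  · refine eq_univ_of_forall fun z => ?_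
    obtain ⟨q, hq⟩ := exists_cell h hh z
    cases hc : c q.1 q.2
    · exact Or.inr (mem_biUnion (show q ∈ {q : ℤ × ℤ | c q.1 q.2 = false} from hc) hq)
    · exact Or.inl (mem_biUnion (show q ∈ {q : ℤ × ℤ | c q.1 q.2 = true} from hc) hq)
  · rintro z ⟨hz1, hz2⟩
    simp only [mem_iUnion, mem_setOf_eq, exists_prop] at hz1 hz2
    obtain ⟨q1, c1, m1⟩ := hz1
    obtain ⟨q2, c2, m2⟩ := hz2
    obtain ⟨a, b, hab, hseg⟩ := edge_of_two h hh c z q1 q2 m1 m2 (by rw [c1, c2]; simp)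
    have := hpall a b hab (hreach a b hab)
    rw [SimpleGraph.Walk.toSubgraph_adj_iff] at this
    obtain ⟨i, hi, hil⟩ := this
    rw [himg, mem_iUnion]
    refine ⟨⟨i, hil⟩, ?_⟩
    simp only
    rcases Sym2.eq_iff.1 hi with ⟨e1, e2⟩ | ⟨e1, e2⟩
    · rw [← e1, ← e2] at hseg
      exact hseg
    · rw [← e1, ← e2, segment_symm] at hseg
      exact hseg
  · intro z hz
    obtain ⟨q, hq⟩ := exists_cell h hh z
    obtain ⟨q', hd', hc⟩ := hcol z (Or.inl hz) q hq
    refine mem_biUnion (show q ∈ {q : ℤ × ℤ | c q.1 q.2 = true} from ?_) hq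
    simp only [mem_setOf_eq, hc, decide_eq_true_eq, hEo]
    have := lip (pos h q') z
    rw [hE0 z hz, dist_comm] at this
    linarith
  · intro z hz
    obtain ⟨q, hq⟩ := exists_cell h hh z
    obtain ⟨q', hd', hc⟩ := hcol z (Or.inr hz) q hq
    refine mem_biUnion (show q ∈ {q : ℤ × ℤ | c q.1 q.2 = false} from ?_) hq
    simp only [mem_setOf_eq, hc, decide_eq_false_iff_not, hEo, not_lt]
    have := lip z (pos h q')
    have := hF3 z hz
    linarith

theorem stmt0 (E F : Set (OnePoint ℂ))
    (hEne : E.Nonempty) (hFne : F.Nonempty)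
    (hEcl : IsClosed E) (hFcl : IsClosed F)
    (hdisj : Disjoint E F) (hinf : ∞ ∈ F)
    (hU : IsConnected ((E ∪ F)ᶜ)) :
    ∃ γ : ℝ → ℂ, IsJordanLoop γ ∧
      (fun z : ℂ => (z : OnePoint ℂ)) '' (γ '' Set.Icc 0 1) ⊆ (E ∪ F)ᶜ ∧
      FinUnionHV (γ '' Set.Icc 0 1) ∧
      ∀ e ∈ E, ∀ f ∈ F,
        f ∉ connectedComponentIn
          (((fun z : ℂ => (z : OnePoint ℂ)) '' (γ '' Set.Icc 0 1))ᶜ) e := by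
  set ι : ℂ → OnePoint ℂ := fun z => (z : OnePoint ℂ) with hι
  have hemb : Topology.IsOpenEmbedding ι := OnePoint.isOpenEmbedding_coe
  have hinfE : ∞ ∉ E := fun h => disjoint_left.1 hdisj h hinf
  have hlift : ∀ x : OnePoint ℂ, x ≠ ∞ → ∃ z : ℂ, ι z = x := fun x hx =>
    OnePoint.ne_infty_iff_exists.1 hx
  have hEc : IsCompact (ι ⁻¹' E) := ((OnePoint.isClosed_iff_of_notMem hinfE).1 hEcl).2
  have hFc : IsClosed (ι ⁻¹' F) := hFcl.preimage hemb.continuous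
  have hne : (ι ⁻¹' E).Nonempty := by
    obtain ⟨e, he⟩ := hEne
    obtain ⟨z, rfl⟩ := hlift e (fun h => hinfE (h ▸ he))
    exact ⟨z, he⟩
  have hUU : (E ∪ F)ᶜ = ι '' (ι ⁻¹' E ∪ ι ⁻¹' F)ᶜ := by
    ext x
    constructor
    · intro hx
      obtain ⟨z, rfl⟩ := hlift x (fun h => hx (Or.inr (h ▸ hinf)))
      exact ⟨z, hx, rfl⟩
    · rintro ⟨z, hz, rfl⟩
      exact hz
  have hU0 : IsConnected (ι ⁻¹' E ∪ ι ⁻¹' F)ᶜ := by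
    rw [hUU] at hU
    exact ⟨hU.nonempty.of_image, hemb.isInducing.isPreconnected_image.1 hU.isPreconnected⟩
  obtain ⟨γ, hγ, hsub, hhv, KB, KW, hB, hW, hun, hint, hEB, hFW⟩ :=
    plane _ _ hEc hne hFc (hdisj.preimage ι) hU0
  refine ⟨γ, hγ, ?_, hhv, ?_⟩
  · rw [hUU]; exact image_mono hsub
  · intro e he f hf hfc
    have hpre : IsPreconnected (connectedComponentIn (ι '' (γ '' Icc 0 1))ᶜ e) :=
      isPreconnected_connectedComponentIn
    have hCs := connectedComponentIn_subset (ι '' (γ '' Icc 0 1))ᶜ e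
    have hec : e ∈ connectedComponentIn (ι '' (γ '' Icc 0 1))ᶜ e := mem_connectedComponentIn (connectedComponentIn_nonempty_iff.1 ⟨f, hfc⟩)
    have c1 : IsClosed (ι '' KB) := (hB.image hemb.continuous).isClosed
    have c2 : IsClosed (ι '' KWᶜ)ᶜ := (hemb.isOpenMap _ hW.isOpen_compl).isClosed_compl
    have hcov : ∀ x, x ∈ ι '' KB ∪ (ι '' KWᶜ)ᶜ := by
      intro x
      by_cases hx : x ∈ ι '' KWᶜ
      · obtain ⟨z, hz, rfl⟩ := hx
        have : z ∈ KB ∪ KW := hun ▸ mem_univ z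
        exact Or.inl ⟨z, this.resolve_right hz, rfl⟩
      · exact Or.inr hx
    obtain ⟨x, hxC, hx1, hx2⟩ := isPreconnected_closed_iff.1 hpre _ _ c1 c2 (fun x _ => hcov x)
      ⟨e, hec, by
        obtain ⟨z, rfl⟩ := hlift e (fun h => hinfE (h ▸ he))
        exact ⟨z, hEB he, rfl⟩⟩
      ⟨f, hfc, by
        rintro ⟨z, hz, rfl⟩
        exact hz (hFW hf)⟩
    obtain ⟨z, hz, rfl⟩ := hx1
    have hzW : z ∈ KW := by
      by_contra h
      exact hx2 ⟨z, h, rfl⟩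
    exact hCs hxC ⟨z, hint ⟨hz, hzW⟩, rfl⟩
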